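/- Let f be analytic on a neighborhood of 0 in ℂ² with an isolated singularity at 0 and with vanishing 6-jet at 0 (all partial derivatives of f at 0 of order ≤ 6 vanish, i.e. the Taylor expansion of f at 0 contains only terms of degree ≥ 7). Then f deforms to J_{3,0}: there exist an integer m ≥ 1 and a function F(x,y,u), analytic on a neighborhood of 0 in ℂ² × ℂ^m, with F(x,y,0) = f(x,y), such that for every ε > 0 there exist u ∈ ℂ^m with 0 < ‖u‖ < ε and b, c ∈ ℂ with 4b³ + 27 ≠ 0 for which the germ at 0 of (x,y) ↦ F(x,y,u) is right equivalent to the germ at 0 of x³ + b x²y³ + y⁹ + c x y⁷. -/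

import Mathlib

open Filter

/-- The germs at `0` of `g₁` and `g₂` are (smoothly/holomorphically) right equivalent:
there is a map `φ`, analytic on a neighborhood of `0`, with `φ 0 = 0` and invertible
derivative at `0`, such that `g₁ = g₂ ∘ φ` near `0`. -/
def RightEquiv (g₁ g₂ : ℂ × ℂ → ℂ) : Prop :=
  ∃ φ : ℂ × ℂ → ℂ × ℂ, φ 0 = 0 ∧ AnalyticAt ℂ φ 0 ∧
    (∃ L : (ℂ × ℂ) ≃L[ℂ] ℂ × ℂ, fderiv ℂ φ 0 = (L : (ℂ × ℂ) →L[ℂ] ℂ × ℂ)) ∧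
    ∀ᶠ p in nhds (0 : ℂ × ℂ), g₁ p = g₂ (φ p)

/-- The normal form `x³ + b x² y³ + y⁹ + c x y⁷` of the class `J_{3,0}`. -/
noncomputable def J30 (b c : ℂ) (p : ℂ × ℂ) : ℂ :=
  p.1 ^ 3 + b * p.1 ^ 2 * p.2 ^ 3 + p.2 ^ 9 + c * p.1 * p.2 ^ 7

/-- The algebra of power series over `R` with absolutely summable coefficients. -/
def summableSubalgebra (R : Type*) [NormedCommRing R] [NormedAlgebra ℂ R] :
    Subalgebra ℂ (PowerSeries R) where
  carrier := {p | Summable fun n => ‖PowerSeries.coeff n p‖}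
  mul_mem' {p q} hp hq := by
    simpa only [Set.mem_ofPred_eq, PowerSeries.coeff_mul] using
      summable_norm_sum_mul_antidiagonal_of_summable_norm hp hq
  add_mem' {p q} hp hq := by
    refine Summable.of_nonneg_of_le (fun _ => norm_nonneg _) (fun n => ?_) (Summable.add hp hq)
    simpa using norm_add_le _ _
  algebraMap_mem' r := by
    refine summable_of_ne_finset_zero (s := {0}) fun n hn => ?_
    have : n ≠ 0 := by simpa using hn
    simp [PowerSeries.algebraMap_apply, PowerSeries.coeff_C, this]

/-- Power series over `R` with absolutely summable coefficients, with the `ℓ¹` norm. -/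
def SummableSeries (R : Type*) [NormedCommRing R] [NormedAlgebra ℂ R] : Type _ :=
  summableSubalgebra R

namespace SummableSeries

variable {R : Type*} [NormedCommRing R] [NormedAlgebra ℂ R]

noncomputable instance : CommRing (SummableSeries R) :=
  inferInstanceAs (CommRing (summableSubalgebra R))

noncomputable instance : Algebra ℂ (SummableSeries R) :=
  inferInstanceAs (Algebra ℂ (summableSubalgebra R))

/-- The `n`-th coefficient as a linear map. -/
noncomputable def coeffₗ (n : ℕ) : SummableSeries R →ₗ[ℂ] R where
  toFun p := PowerSeries.coeff n p.1
  map_add' p q := map_add (PowerSeries.coeff n) p.1 q.1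
  map_smul' c p := by
    change PowerSeries.coeff n (c • p.1) = _
    simp

theorem summable_norm_coeff (p : SummableSeries R) : Summable fun n => ‖coeffₗ n p‖ := p.2

@[ext]
theorem ext {p q : SummableSeries R} (h : ∀ n, coeffₗ n p = coeffₗ n q) : p = q :=
  Subtype.ext (PowerSeries.ext h)

theorem coeffₗ_mul (n : ℕ) (p q : SummableSeries R) :
    coeffₗ n (p * q) =
      ∑ ij ∈ Finset.HasAntidiagonal.antidiagonal n, coeffₗ ij.1 p * coeffₗ ij.2 q :=
  PowerSeries.coeff_mul n p.1 q.1

/-- The summable series with prescribed coefficients. -/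
def ofCoeff (a : ℕ → R) (ha : Summable fun n => ‖a n‖) : SummableSeries R :=
  ⟨PowerSeries.mk a, by simpa [summableSubalgebra] using ha⟩

@[simp]
theorem coeffₗ_ofCoeff (a : ℕ → R) (ha) (n : ℕ) : coeffₗ n (ofCoeff a ha) = a n :=
  PowerSeries.coeff_mk n a

noncomputable instance : Norm (SummableSeries R) := ⟨fun p => ∑' n, ‖coeffₗ n p‖⟩

theorem norm_def (p : SummableSeries R) : ‖p‖ = ∑' n, ‖coeffₗ n p‖ := rfl

theorem norm_coeffₗ_le (n : ℕ) (p : SummableSeries R) : ‖coeffₗ n p‖ ≤ ‖p‖ :=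
  p.summable_norm_coeff.le_tsum n fun _ _ => norm_nonneg _

theorem normedSpaceCore : NormedSpace.Core ℂ (SummableSeries R) where
  norm_nonneg p := tsum_nonneg fun _ => norm_nonneg _
  norm_smul c p := by simp [norm_def, norm_smul, tsum_mul_left]
  norm_triangle p q := by
    rw [norm_def, norm_def, norm_def,
      ← p.summable_norm_coeff.tsum_add q.summable_norm_coeff]
    refine (p + q).summable_norm_coeff.tsum_le_tsum (fun n => ?_)
      (p.summable_norm_coeff.add q.summable_norm_coeff)
    simpa using norm_add_le _ _
  norm_eq_zero_iff p := by
    refine ⟨fun h => ext fun n => ?_, fun h => by simp [h, norm_def]⟩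
    simpa [h] using norm_coeffₗ_le n p

noncomputable instance : NormedAddCommGroup (SummableSeries R) :=
  NormedAddCommGroup.ofCore normedSpaceCore

theorem norm_mul_le_mul_norm (p q : SummableSeries R) : ‖p * q‖ ≤ ‖p‖ * ‖q‖ := by
  have hp : Summable fun n => ‖‖coeffₗ n p‖‖ := by simpa using p.summable_norm_coeff
  have hq : Summable fun n => ‖‖coeffₗ n q‖‖ := by simpa using q.summable_norm_coeff
  rw [norm_def, norm_def, norm_def,
    tsum_mul_tsum_eq_tsum_sum_antidiagonal_of_summable_norm hp hq]
  refine (p * q).summable_norm_coeff.tsum_le_tsum (fun n => ?_)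
    (summable_norm_sum_mul_antidiagonal_of_summable_norm hp hq).of_norm
  rw [coeffₗ_mul]
  exact (norm_sum_le _ _).trans (Finset.sum_le_sum fun _ _ => norm_mul_le _ _)

noncomputable instance : NormedCommRing (SummableSeries R) where
  dist_eq p q := NormedAddGroup.dist_eq p q
  norm_mul_le := norm_mul_le_mul_norm
  mul_comm := mul_comm

noncomputable instance : NormedAlgebra ℂ (SummableSeries R) where
  norm_smul_le c p := (normedSpaceCore.norm_smul c p).le

/-- The coefficient sequence, as an isometry onto the sequence space `ℓ¹`. -/
noncomputable def isometryEquivLp : SummableSeries R ≃ᵢ lp (fun _ : ℕ => R) 1 where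
  toFun p := ⟨fun n => coeffₗ n p, memℓp_gen (by simpa using p.summable_norm_coeff)⟩
  invFun a := ofCoeff a (by simpa using (memℓp_gen_iff (by simp)).1 (lp.memℓp a))
  left_inv p := by ext; simp
  right_inv a := by ext; simp
  isometry_toFun := Isometry.of_dist_eq fun p q => by
    rw [dist_eq_norm, dist_eq_norm, lp.norm_eq_tsum_rpow (by simp), norm_def]
    simp only [ENNReal.toReal_one, Real.rpow_one, ne_eq, one_ne_zero, not_false_eq_true, div_self,
      map_sub]
    rfl

instance [CompleteSpace R] : CompleteSpace (SummableSeries R) :=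
  isometryEquivLp.completeSpace_iff.2 inferInstance

/-- The `n`-th coefficient as a continuous linear map. -/
noncomputable def coeffL (n : ℕ) : SummableSeries R →L[ℂ] R :=
  (coeffₗ n).mkContinuous 1 fun p => by simpa using norm_coeffₗ_le n p

@[simp]
theorem coeffL_apply (n : ℕ) (p : SummableSeries R) : coeffL n p = coeffₗ n p := rfl

theorem norm_coeffL_le (n : ℕ) : ‖coeffL n (R := R)‖ ≤ 1 :=
  ContinuousLinearMap.opNorm_le_bound _ zero_le_one fun p => by
    simpa using norm_coeffₗ_le n p

/-- The variable, as a summable series. -/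
noncomputable def X : SummableSeries R :=
  ofCoeff (fun n => if n = 1 then 1 else 0) <|
    summable_of_ne_finset_zero (s := {1}) fun n hn => by
      have : n ≠ 1 := by simpa using hn
      simp [this]

/-- A constant, as a summable series. -/
noncomputable def C (r : R) : SummableSeries R :=
  ofCoeff (fun n => if n = 0 then r else 0) <|
    summable_of_ne_finset_zero (s := {0}) fun n hn => by
      have : n ≠ 0 := by simpa using hn
      simp [this]

@[simp]
theorem coeffₗ_X (n : ℕ) : coeffₗ n (X : SummableSeries R) = if n = 1 then 1 else 0 :=
  coeffₗ_ofCoeff _ _ n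

@[simp]
theorem coeffₗ_C (r : R) (n : ℕ) : coeffₗ n (C r) = if n = 0 then r else 0 :=
  coeffₗ_ofCoeff _ _ n

theorem coeffₗ_zero_X_mul (p : SummableSeries R) : coeffₗ 0 (X * p) = 0 := by
  simp [coeffₗ_mul]

theorem coeffₗ_succ_X_mul (n : ℕ) (p : SummableSeries R) :
    coeffₗ (n + 1) (X * p) = coeffₗ n p := by
  rw [coeffₗ_mul, Finset.Nat.sum_antidiagonal_succ, Finset.sum_eq_single (0, n)] <;> simp
  rintro a b h1 h2 rfl
  exact absurd (by simpa using h1) (h2 rfl)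

theorem exists_eq_C_add_X_mul (p : SummableSeries R) :
    ∃ q : SummableSeries R, p = C (coeffₗ 0 p) + X * q ∧
      ∀ n, coeffₗ n q = coeffₗ (n + 1) p := by
  refine ⟨ofCoeff (fun n => coeffₗ (n + 1) p)
    ((summable_nat_add_iff 1).2 p.summable_norm_coeff), ext fun n => ?_, by simp⟩
  cases n with
  | zero => simp [coeffₗ_zero_X_mul]
  | succ n => simp [coeffₗ_succ_X_mul]

theorem norm_pow_smul_coeffL_le (z : ℂ) (n : ℕ) :
    ‖z ^ n • coeffL n (R := R)‖ ≤ ‖z‖ ^ n := by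
  rw [norm_smul, norm_pow]
  exact mul_le_of_le_one_right (by positivity) (norm_coeffL_le n)

section Eval

variable [CompleteSpace R]

/-- Evaluation of a summable series at a point of the open unit disc. -/
noncomputable def evalL (z : ℂ) : SummableSeries R →L[ℂ] R := ∑' n, z ^ n • coeffL n

theorem summable_pow_smul_coeffL {z : ℂ} (hz : ‖z‖ < 1) :
    Summable fun n => z ^ n • coeffL n (R := R) :=
  Summable.of_norm_bounded (summable_geometric_of_lt_one (norm_nonneg _) hz)
    (norm_pow_smul_coeffL_le z)

theorem hasSum_evalL {z : ℂ} (hz : ‖z‖ < 1) (p : SummableSeries R) :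
    HasSum (fun n => z ^ n • coeffₗ n p) (evalL z p) :=
  (summable_pow_smul_coeffL hz).hasSum.mapL (ContinuousLinearMap.apply ℂ R p)

theorem evalL_mul {z : ℂ} (hz : ‖z‖ < 1) (p q : SummableSeries R) :
    evalL z (p * q) = evalL z p * evalL z q := by
  have hs (p : SummableSeries R) : Summable fun n => ‖z ^ n • coeffₗ n p‖ :=
    Summable.of_nonneg_of_le (fun _ => norm_nonneg _) (fun n => by
      rw [norm_smul, norm_pow]
      exact mul_le_of_le_one_left (norm_nonneg _) (pow_le_one₀ (norm_nonneg _) hz.le))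
      p.summable_norm_coeff
  rw [← (hasSum_evalL hz p).tsum_eq, ← (hasSum_evalL hz q).tsum_eq,
    ← (hasSum_evalL hz (p * q)).tsum_eq,
    tsum_mul_tsum_eq_tsum_sum_antidiagonal_of_summable_norm (hs p) (hs q)]
  refine tsum_congr fun n => ?_
  rw [coeffₗ_mul, Finset.smul_sum]
  refine Finset.sum_congr rfl fun ij hij => ?_
  rw [smul_mul_smul_comm, ← pow_add, Finset.HasAntidiagonal.mem_antidiagonal.1 hij]

theorem evalL_C {z : ℂ} (hz : ‖z‖ < 1) (r : R) : evalL z (C r) = r := by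
  refine (hasSum_evalL hz _).unique ?_
  convert hasSum_ite_eq 0 r using 2 with n
  by_cases h : n = 0 <;> simp [h]

theorem evalL_X {z : ℂ} (hz : ‖z‖ < 1) : evalL z (X : SummableSeries R) = z • 1 := by
  refine (hasSum_evalL hz _).unique ?_
  convert hasSum_ite_eq 1 (z • (1 : R)) using 2 with n
  by_cases h : n = 1 <;> simp [h]

theorem analyticAt_evalL {z : ℂ} (hz : ‖z‖ < 1) :
    AnalyticAt ℂ (fun z => evalL z (R := R)) z := by
  obtain ⟨r, hzr, hr⟩ := exists_between hz
  refine DifferentiableOn.analyticAt (s := Metric.ball 0 r) ?_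
    (Metric.isOpen_ball.mem_nhds (by simpa using hzr))
  refine Complex.differentiableOn_tsum_of_summable_norm
    (summable_geometric_of_lt_one ((norm_nonneg _).trans hzr.le) hr)
    (fun n => by fun_prop) Metric.isOpen_ball fun n w hw => ?_
  exact (norm_pow_smul_coeffL_le w n).trans
    (pow_le_pow_left₀ (norm_nonneg _) (mem_ball_zero_iff.1 hw).le n)

end Eval

theorem coeffₗ_C_mul (r : R) (n : ℕ) (p : SummableSeries R) :
    coeffₗ n (C r * p) = r * coeffₗ n p := by
  rw [coeffₗ_mul, Finset.sum_eq_single (0, n)]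
  · simp
  · rintro ⟨a, b⟩ h1 h2
    have : a ≠ 0 := by
      rintro rfl
      exact h2 (by simpa using h1)
    simp [this]
  · simp

theorem C_mul (r s : R) : C (r * s) = C r * C s := by
  ext n
  simp [coeffₗ_C_mul]

theorem C_add (r s : R) : C (r + s) = C r + C s := by
  ext n
  by_cases h : n = 0 <;> simp [h]

theorem C_pow_mul (r s : R) (n : ℕ) : C (r ^ n * s) = C r ^ n * C s := by
  induction n with
  | zero => simp
  | succ n ih => rw [pow_succ', mul_assoc, C_mul, ih, pow_succ', mul_assoc]

theorem C_one : C (1 : R) = 1 := by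
  have h : C (1 : R) * 1 = 1 := by
    ext n
    rw [coeffₗ_C_mul, one_mul]
  simpa using h

theorem C_smul (c : ℂ) (r : R) : C (c • r) = c • C r := by
  ext n
  by_cases h : n = 0 <;> simp [h]

theorem exists_eq_X_pow_mul (n : ℕ) (p : SummableSeries R) (hp : ∀ i < n, coeffₗ i p = 0) :
    ∃ q : SummableSeries R, p = X ^ n * q ∧ ∀ i, coeffₗ i q = coeffₗ (i + n) p := by
  induction n with
  | zero => exact ⟨p, by simp, fun i => rfl⟩
  | succ n ih =>
    obtain ⟨q, hq, hc⟩ := ih fun i hi => hp i (hi.trans n.lt_succ_self)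
    obtain ⟨q', hq', hc'⟩ := q.exists_eq_C_add_X_mul
    have h0 : C (coeffₗ 0 q) = 0 := by
      rw [hc, zero_add, hp n n.lt_succ_self]
      ext i
      simp
    rw [h0, zero_add] at hq'
    refine ⟨q', by rw [hq, hq']; ring, fun i => ?_⟩
    rw [hc', hc]
    congr 1
    congr 1
    ring

end SummableSeries

open SummableSeries

/-- Double power series in two variables with absolutely summable coefficients. -/
abbrev BiSeries : Type := SummableSeries (SummableSeries ℂ)

namespace BiSeries

/-- The first variable. -/
noncomputable def x : BiSeries := X

/-- The second variable. -/
noncomputable def y : BiSeries := C X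

/-- Evaluation at a point of the open unit bidisc, as a continuous linear functional. -/
noncomputable def evL (p : ℂ × ℂ) : BiSeries →L[ℂ] ℂ := (evalL p.2).comp (evalL p.1)

theorem norm_fst_lt {p : ℂ × ℂ} (hp : ‖p‖ < 1) : ‖p.1‖ < 1 := (norm_fst_le p).trans_lt hp

theorem norm_snd_lt {p : ℂ × ℂ} (hp : ‖p‖ < 1) : ‖p.2‖ < 1 := (norm_snd_le p).trans_lt hp

/-- Evaluation at a point of the open unit bidisc, as an algebra homomorphism. -/
noncomputable def ev (p : ℂ × ℂ) (hp : ‖p‖ < 1) : BiSeries →ₐ[ℂ] ℂ :=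
  AlgHom.ofLinearMap (evL p)
    (by
      change evalL p.2 (evalL p.1 1) = 1
      rw [← C_one, evalL_C (norm_fst_lt hp), ← C_one, evalL_C (norm_snd_lt hp)])
    (fun S T => by
      change evalL p.2 (evalL p.1 (S * T)) = _
      rw [evalL_mul (norm_fst_lt hp), evalL_mul (norm_snd_lt hp)]
      rfl)

theorem ev_apply {p : ℂ × ℂ} (hp : ‖p‖ < 1) (T : BiSeries) : ev p hp T = evL p T := rfl

theorem ev_x {p : ℂ × ℂ} (hp : ‖p‖ < 1) : ev p hp x = p.1 := by
  change evalL p.2 (evalL p.1 X) = _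
  rw [evalL_X (norm_fst_lt hp), map_smul, ← C_one, evalL_C (norm_snd_lt hp)]
  simp

theorem ev_y {p : ℂ × ℂ} (hp : ‖p‖ < 1) : ev p hp y = p.2 := by
  change evalL p.2 (evalL p.1 (C X)) = _
  rw [evalL_C (norm_fst_lt hp), evalL_X (norm_snd_lt hp)]
  simp

theorem analyticAt_evL (T : BiSeries) : AnalyticAt ℂ (fun p => evL p T) 0 := by
  have h1 : AnalyticAt ℂ (fun p : ℂ × ℂ => evalL p.1 (R := SummableSeries ℂ)) 0 :=
    AnalyticAt.fun_comp (g := fun z => evalL z (R := SummableSeries ℂ))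
      (analyticAt_evalL (by simp)) analyticAt_fst
  have h2 : AnalyticAt ℂ (fun p : ℂ × ℂ => evalL p.2 (R := ℂ)) 0 :=
    AnalyticAt.fun_comp (g := fun z => evalL z (R := ℂ)) (analyticAt_evalL (by simp)) analyticAt_snd
  have h3 : AnalyticAt ℂ (fun p : ℂ × ℂ => evalL p.1 T) 0 :=
    ((ContinuousLinearMap.apply ℂ (SummableSeries ℂ) T).analyticAt _).fun_comp h1
  exact ((ContinuousLinearMap.id ℂ (SummableSeries ℂ →L[ℂ] ℂ)).analyticAt_bilinear
    _).fun_comp (h2.prod h3)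

theorem exists_eq_add (T : BiSeries) : ∃ (a b : ℂ) (S S' : BiSeries),
    T = a • 1 + b • y + y ^ 2 * S + x * S' := by
  obtain ⟨S', hT, -⟩ := T.exists_eq_C_add_X_mul
  obtain ⟨q, hq, -⟩ := (coeffₗ 0 T).exists_eq_C_add_X_mul
  obtain ⟨q', hq', -⟩ := q.exists_eq_C_add_X_mul
  refine ⟨coeffₗ 0 (coeffₗ 0 T), coeffₗ 0 q, C q', S', ?_⟩
  have key (c : ℂ) : (C c : SummableSeries ℂ) = c • 1 := by
    rw [← C_one, ← C_smul]; simp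
  have h : coeffₗ 0 T = coeffₗ 0 (coeffₗ 0 T) • 1 + coeffₗ 0 q • X + X ^ 2 * q' := by
    conv_lhs => rw [hq, hq', key, key]
    simp only [mul_add, mul_smul_comm, mul_one, ← mul_assoc]
    rw [pow_two, add_assoc]
  conv_lhs => rw [hT, h, C_add, C_add, C_smul, C_smul, C_one, C_pow_mul]
  rfl

/-- The double series with prescribed coefficients. -/
noncomputable def ofCoeffs (c : ℕ × ℕ → ℂ) (hc : Summable fun ij => ‖c ij‖) : BiSeries :=
  ofCoeff (fun i => ofCoeff (fun j => c (i, j)) (hc.prod_factor i)) <| by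
    simpa only [norm_def, coeffₗ_ofCoeff] using hc.prod

@[simp]
theorem coeffₗ_ofCoeffs (c : ℕ × ℕ → ℂ) (hc) (i j : ℕ) :
    coeffₗ j (coeffₗ i (ofCoeffs c hc)) = c (i, j) := by
  simp [ofCoeffs]

theorem norm_ofCoeffs (c : ℕ × ℕ → ℂ) (hc) : ‖ofCoeffs c hc‖ = ∑' ij, ‖c ij‖ := by
  rw [hc.tsum_prod]
  simp [norm_def, ofCoeffs]

theorem hasSum_evL_ofCoeffs (c : ℕ × ℕ → ℂ) (hc) {p : ℂ × ℂ} (hp : ‖p‖ < 1) :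
    HasSum (fun ij => c ij * (p.1 ^ ij.1 * p.2 ^ ij.2)) (evL p (ofCoeffs c hc)) := by
  have hs : Summable fun ij : ℕ × ℕ => c ij * (p.1 ^ ij.1 * p.2 ^ ij.2) := by
    refine Summable.of_norm_bounded hc fun ij => ?_
    rw [norm_mul, norm_mul, norm_pow, norm_pow]
    refine mul_le_of_le_one_right (norm_nonneg _) (mul_le_one₀ ?_ (by positivity) ?_)
    · exact pow_le_one₀ (norm_nonneg _) (norm_fst_lt hp).le
    · exact pow_le_one₀ (norm_nonneg _) (norm_snd_lt hp).le
  have h1 : HasSum (fun i => p.1 ^ i • evalL p.2 (coeffₗ i (ofCoeffs c hc)))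
      (evL p (ofCoeffs c hc)) := by
    have h := (hasSum_evalL (norm_fst_lt hp) (ofCoeffs c hc)).mapL (evalL p.2)
    simp only [map_smul] at h
    exact h
  have h2 (i : ℕ) : HasSum (fun j => c (i, j) * (p.1 ^ i * p.2 ^ j))
      (p.1 ^ i • evalL p.2 (coeffₗ i (ofCoeffs c hc))) := by
    have h := (hasSum_evalL (norm_snd_lt hp) (coeffₗ i (ofCoeffs c hc))).mul_left (p.1 ^ i)
    refine h.congr_fun fun j => ?_
    rw [coeffₗ_ofCoeffs, smul_eq_mul]
    ring
  rw [← (hs.hasSum.prod_fiberwise h2).unique h1]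
  exact hs.hasSum

end BiSeries

/-- The coefficient of `x ^ i * y ^ (n - i)` in the `n`-th term of a formal multilinear series
on `ℂ × ℂ`, restricted to the diagonal. -/
noncomputable def diagCoeff (P : FormalMultilinearSeries ℂ (ℂ × ℂ) ℂ) (n i : ℕ) : ℂ :=
  ∑ s ∈ Finset.powersetCard i (Finset.univ : Finset (Fin n)),
    P n (s.piecewise (fun _ => (1, 0)) fun _ => (0, 1))

theorem apply_diag_eq_sum_diagCoeff (P : FormalMultilinearSeries ℂ (ℂ × ℂ) ℂ) (n : ℕ) (x y : ℂ) :
    P n (fun _ => (x, y)) = ∑ ij ∈ Finset.HasAntidiagonal.antidiagonal n,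
      diagCoeff P (ij.1 + ij.2) ij.1 * (x ^ ij.1 * y ^ ij.2) := by
  have h1 : (fun _ : Fin n => (x, y)) = (fun _ => x • ((1 : ℂ), (0 : ℂ))) +
      fun _ => y • ((0 : ℂ), (1 : ℂ)) := by
    ext <;> simp
  have h2 (s : Finset (Fin n)) :
      P n (s.piecewise (fun _ => x • ((1 : ℂ), (0 : ℂ))) fun _ => y • ((0 : ℂ), (1 : ℂ))) =
      (x ^ s.card * y ^ (n - s.card)) * P n (s.piecewise (fun _ => (1, 0)) fun _ => (0, 1)) := by
    have h3 : (s.piecewise (fun _ => x • ((1 : ℂ), (0 : ℂ))) fun _ => y • ((0 : ℂ), (1 : ℂ))) =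
        fun i => (s.piecewise (fun _ => x) (fun _ => y) i) •
          (s.piecewise (fun _ => ((1 : ℂ), (0 : ℂ))) (fun _ => ((0 : ℂ), (1 : ℂ))) i) := by
      ext i <;> by_cases hi : i ∈ s <;> simp [hi]
    rw [h3, ContinuousMultilinearMap.map_smul_univ, Finset.prod_piecewise, smul_eq_mul]
    simp [Finset.card_sdiff_of_subset]
  have hcongr : ∀ ij ∈ Finset.HasAntidiagonal.antidiagonal n,
      diagCoeff P (ij.1 + ij.2) ij.1 * (x ^ ij.1 * y ^ ij.2) =
        diagCoeff P n ij.1 * (x ^ ij.1 * y ^ ij.2) := by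
    intro ij hij
    rw [Finset.HasAntidiagonal.mem_antidiagonal.1 hij]
  rw [Finset.sum_congr rfl hcongr, Finset.Nat.sum_antidiagonal_eq_sum_range_succ
    (fun i j => diagCoeff P n i * (x ^ i * y ^ j)), h1, ContinuousMultilinearMap.map_add_univ,
    Finset.sum_congr rfl fun s _ => h2 s, ← Finset.powerset_univ, Finset.sum_powerset]
  simp only [Finset.card_univ, Fintype.card_fin, diagCoeff, Finset.sum_mul]
  refine Finset.sum_congr rfl fun i _ => Finset.sum_congr rfl fun s hs => ?_
  rw [(Finset.mem_powersetCard.1 hs).2, mul_comm]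

theorem norm_diagCoeff_le (P : FormalMultilinearSeries ℂ (ℂ × ℂ) ℂ) (n i : ℕ) :
    ‖diagCoeff P n i‖ ≤ 2 ^ n * ‖P n‖ := by
  refine ((norm_sum_le _ _).trans (Finset.sum_le_sum_of_subset_of_nonneg (Finset.subset_univ _)
    fun _ _ _ => norm_nonneg _)).trans ?_
  refine (Finset.sum_le_card_nsmul _ _ ‖P n‖ fun s _ => ?_).trans (by simp)
  refine ((P n).le_opNorm _).trans (mul_le_of_le_one_right (norm_nonneg _) ?_)
  refine Finset.prod_le_one (fun _ _ => norm_nonneg _) fun j _ => ?_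
  by_cases hj : j ∈ s <;> simp [hj, Prod.norm_def]

/-- An analytic germ on `ℂ²` is the sum of an absolutely convergent double power series. -/
theorem AnalyticAt.exists_hasSum_double {f : ℂ × ℂ → ℂ} (hf : AnalyticAt ℂ f 0) :
    ∃ ρ > (0 : ℝ), ∃ c : ℕ × ℕ → ℂ, (Summable fun ij => ‖c ij‖ * ρ ^ (ij.1 + ij.2)) ∧
      (∀ p : ℂ × ℂ, ‖p‖ < ρ → HasSum (fun ij => c ij * (p.1 ^ ij.1 * p.2 ^ ij.2)) (f p)) ∧
      ∀ n x y, ∑ ij ∈ Finset.HasAntidiagonal.antidiagonal n, c ij * (x ^ ij.1 * y ^ ij.2) =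
        (n.factorial : ℂ)⁻¹ * iteratedFDeriv ℂ n f 0 (fun _ => (x, y)) := by
  obtain ⟨P, r, hP⟩ := hf
  obtain ⟨C, K, hC, hK, hb⟩ :=
    P.le_mul_pow_of_radius_pos (hP.r_pos.trans_le hP.r_le)
  obtain ⟨δ, hδ, hδr⟩ : ∃ δ : ℝ, 0 < δ ∧ ENNReal.ofReal δ ≤ r := by
    obtain ⟨δ, h0, h1⟩ := ENNReal.lt_iff_exists_nnreal_btwn.1 hP.r_pos
    exact ⟨δ, by exact_mod_cast h0, by simpa using h1.le⟩
  set ρ := min δ (1 / (4 * K)) with hρ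
  have hρ0 : 0 < ρ := lt_min hδ (by positivity)
  have hs : Summable fun ij : ℕ × ℕ =>
      ‖diagCoeff P (ij.1 + ij.2) ij.1‖ * ρ ^ (ij.1 + ij.2) := by
    have hg : Summable fun ij : ℕ × ℕ => C * ((1 / 2 : ℝ) ^ ij.1 * (1 / 2 : ℝ) ^ ij.2) :=
      (summable_geometric_two.mul_of_nonneg summable_geometric_two
        (fun _ => by positivity) (fun _ => by positivity)).mul_left C
    refine Summable.of_nonneg_of_le (fun _ => by positivity) (fun ij => ?_) hg
    rw [← pow_add]
    set n := ij.1 + ij.2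
    have hKρ : 2 * K * ρ ≤ 1 / 2 := by
      calc 2 * K * ρ ≤ 2 * K * (1 / (4 * K)) := by gcongr; exact min_le_right _ _
        _ = 1 / 2 := by field_simp; norm_num
    calc ‖diagCoeff P n ij.1‖ * ρ ^ n ≤ (2 ^ n * (C * K ^ n)) * ρ ^ n := by
          gcongr
          exact (norm_diagCoeff_le P n _).trans (by gcongr; exact hb n)
      _ = C * (2 * K * ρ) ^ n := by rw [mul_pow, mul_pow]; ring
      _ ≤ _ := by gcongr
  refine ⟨ρ, hρ0, fun ij => diagCoeff P (ij.1 + ij.2) ij.1, hs, fun p hp => ?_, fun n x y => ?_⟩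
  · have hs' : Summable fun ij : ℕ × ℕ =>
        diagCoeff P (ij.1 + ij.2) ij.1 * (p.1 ^ ij.1 * p.2 ^ ij.2) := by
      refine Summable.of_norm_bounded hs fun ij => ?_
      rw [norm_mul, norm_mul, norm_pow, norm_pow, pow_add]
      gcongr
      · exact (norm_fst_le p).trans hp.le
      · exact (norm_snd_le p).trans hp.le
    have hf : HasSum (fun n => P n fun _ => p) (f p) := by
      have := hP.hasSum (y := p) (Metric.eball_subset_eball hδr (by
        rw [Metric.eball_ofReal]
        simpa using hp.trans_le (min_le_left _ _)))
      simpa using this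
    have h1 := (Finset.HasAntidiagonal.sigmaAntidiagonalEquivProd (A := ℕ)).hasSum_iff.2
      hs'.hasSum
    have h2 := h1.sigma fun n => hasSum_fintype _
    have h3 : HasSum (fun n => P n fun _ => p)
        (∑' ij : ℕ × ℕ, diagCoeff P (ij.1 + ij.2) ij.1 * (p.1 ^ ij.1 * p.2 ^ ij.2)) := by
      refine h2.congr_fun fun n => ?_
      rw [show (fun _ : Fin n => p) = fun _ => (p.1, p.2) from rfl, apply_diag_eq_sum_diagCoeff,
        ← Finset.sum_finset_coe]
      rfl
    rw [hf.unique h3]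
    exact hs'.hasSum
  · rw [← apply_diag_eq_sum_diagCoeff, ← hP.factorial_smul, nsmul_eq_mul, ← mul_assoc,
      inv_mul_cancel₀ (by exact_mod_cast n.factorial_ne_zero), one_mul]

theorem BiSeries.coeffₗ_smul_one (a : ℂ) (i j : ℕ) :
    coeffₗ j (coeffₗ i (a • (1 : BiSeries))) = if i = 0 ∧ j = 0 then a else 0 := by
  rw [← C_one, ← C_one]
  by_cases hi : i = 0 <;> by_cases hj : j = 0 <;> simp [hi, hj]

/-- Rescaling an analytic germ on `ℂ²` produces double series on the unit bidisc, which tend to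
the value of the germ as the scaling factors tend to zero. -/
theorem AnalyticAt.exists_scaled_series {g : ℂ × ℂ → ℂ} (hg : AnalyticAt ℂ g 0) :
    ∃ T : ℂ × ℂ → BiSeries, Tendsto T (nhds 0) (nhds (g 0 • 1)) ∧
      ∀ᶠ α in nhds (0 : ℂ × ℂ), ∀ p : ℂ × ℂ, ‖p‖ < 1 →
        BiSeries.evL p (T α) = g (α.1 * p.1, α.2 * p.2) := by
  obtain ⟨ρ, hρ, c, hc, hsum, hjet⟩ := hg.exists_hasSum_double
  have h0 : c (0, 0) = g 0 := by simpa using hjet 0 0 0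
  have hle {α : ℂ × ℂ} (hα : ‖α‖ < ρ) (ij : ℕ × ℕ) :
      ‖c ij * (α.1 ^ ij.1 * α.2 ^ ij.2)‖ ≤ ‖c ij‖ * ρ ^ (ij.1 + ij.2) := by
    rw [norm_mul, norm_mul, norm_pow, norm_pow, pow_add]
    gcongr
    · exact (norm_fst_le α).trans hα.le
    · exact (norm_snd_le α).trans hα.le
  have hs {α : ℂ × ℂ} (hα : ‖α‖ < ρ) :
      Summable fun ij : ℕ × ℕ => ‖c ij * (α.1 ^ ij.1 * α.2 ^ ij.2)‖ :=
    Summable.of_nonneg_of_le (fun _ => norm_nonneg _) (hle hα) hc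
  have hball : ∀ᶠ α in nhds (0 : ℂ × ℂ), ‖α‖ < ρ :=
    continuous_norm.tendsto' (0 : ℂ × ℂ) 0 norm_zero |>.eventually_lt_const hρ
  classical
  refine ⟨fun α => if h : ‖α‖ < ρ then BiSeries.ofCoeffs _ (hs h) else 0, ?_, ?_⟩
  · rw [tendsto_iff_norm_sub_tendsto_zero]
    set M := ∑' ij : ℕ × ℕ, ‖c ij‖ * ρ ^ (ij.1 + ij.2)
    have hlim : Tendsto (fun α : ℂ × ℂ => ‖α‖ / ρ * M) (nhds 0) (nhds 0) := by
      have : Continuous fun α : ℂ × ℂ => ‖α‖ / ρ * M := by fun_prop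
      exact this.tendsto' _ _ (by simp)
    refine squeeze_zero' (Eventually.of_forall fun _ => norm_nonneg _) ?_ hlim
    filter_upwards [hball] with α hα
    rw [dif_pos hα]
    set d : ℕ × ℕ → ℂ := fun ij =>
      if ij.1 = 0 ∧ ij.2 = 0 then 0 else c ij * (α.1 ^ ij.1 * α.2 ^ ij.2) with hd
    have hdle (ij : ℕ × ℕ) : ‖d ij‖ ≤ ‖α‖ / ρ * (‖c ij‖ * ρ ^ (ij.1 + ij.2)) := by
      by_cases hij : ij.1 = 0 ∧ ij.2 = 0
      · simp only [hd, if_pos hij, norm_zero]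
        positivity
      · simp only [hd, if_neg hij]
        obtain ⟨n, hn⟩ : ∃ n, ij.1 + ij.2 = n + 1 := Nat.exists_eq_succ_of_ne_zero (by omega)
        calc ‖c ij * (α.1 ^ ij.1 * α.2 ^ ij.2)‖ ≤ ‖c ij‖ * (‖α‖ ^ ij.1 * ‖α‖ ^ ij.2) := by
              rw [norm_mul, norm_mul, norm_pow, norm_pow]
              gcongr
              · exact norm_fst_le α
              · exact norm_snd_le α
          _ = ‖c ij‖ * (‖α‖ * ‖α‖ ^ n) := by rw [← pow_add, hn, pow_succ']
          _ ≤ ‖c ij‖ * (‖α‖ * ρ ^ n) := by gcongr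
          _ = _ := by rw [hn, pow_succ']; field_simp
    have hds : Summable fun ij => ‖d ij‖ :=
      Summable.of_nonneg_of_le (fun _ => norm_nonneg _) hdle (hc.mul_left _)
    have heq : BiSeries.ofCoeffs _ (hs hα) - g 0 • 1 = BiSeries.ofCoeffs d hds := by
      ext i j
      simp only [map_sub, BiSeries.coeffₗ_ofCoeffs, BiSeries.coeffₗ_smul_one, hd]
      by_cases hij : i = 0 ∧ j = 0
      · obtain ⟨rfl, rfl⟩ := hij
        simp [h0]
      · simp [hij]
    rw [heq, BiSeries.norm_ofCoeffs, ← tsum_mul_left]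
    exact hds.tsum_le_tsum hdle (hc.mul_left _)
  · filter_upwards [hball] with α hα p hp
    rw [dif_pos hα]
    have hαp : ‖((α.1 * p.1, α.2 * p.2) : ℂ × ℂ)‖ < ρ := by
      refine lt_of_le_of_lt ?_ hα
      rw [Prod.norm_def, Prod.norm_def, norm_mul, norm_mul]
      exact max_le_max
        (mul_le_of_le_one_right (norm_nonneg _) (BiSeries.norm_fst_lt hp).le)
        (mul_le_of_le_one_right (norm_nonneg _) (BiSeries.norm_snd_lt hp).le)
    refine (BiSeries.hasSum_evL_ofCoeffs _ (hs hα) hp).unique ((hsum _ hαp).congr_fun fun ij => ?_)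
    rw [mul_pow, mul_pow]
    ring

/-- The coefficients of `x ^ 3`, `x ^ 2 * y ^ 3`, `x * y ^ 6`, `y ^ 9` in the pullback of
`x ^ 3 + b * x ^ 2 * y ^ 3 + y ^ 9 + c * x * y ^ 7` along
`(x * η₁ + y ^ 3 * η₂, y * η₃ + x * η₄)`, up to the relation
`x ^ 2 * y ^ 3 * (y ^ 3 * w) = x * y ^ 6 * (x * w)`. -/
noncomputable def pullbackCoeffs
    (e : BiSeries × BiSeries × BiSeries × BiSeries × BiSeries × ℂ × ℂ) :
    BiSeries × BiSeries × BiSeries × BiSeries :=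
  let x := BiSeries.x
  let y := BiSeries.y
  let η₁ := e.1
  let η₂ := e.2.1
  let η₃ := e.2.2.1
  let η₄ := e.2.2.2.1
  let w := e.2.2.2.2.1
  let b := e.2.2.2.2.2.1
  let c := e.2.2.2.2.2.2
  let α := η₃ ^ 3
  let σ := 3 * y ^ 2 * (η₃ ^ 2 * η₄) + 3 * y * x * (η₃ * η₄ ^ 2) + x ^ 2 * η₄ ^ 3
  let φ := y * η₃ + x * η₄
  (η₁ ^ 3 + b • (η₁ ^ 2 * σ) + σ ^ 3 + c • (φ * η₁ * σ ^ 2),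
    3 * η₁ ^ 2 * η₂ + b • (η₁ ^ 2 * α + 2 * η₁ * η₂ * σ) + 3 * σ ^ 2 * α +
      c • (φ * (2 * η₁ * σ * α + η₂ * σ ^ 2)) + y ^ 3 * w,
    3 * η₁ * η₂ ^ 2 + b • (2 * η₁ * η₂ * α + η₂ ^ 2 * σ) + 3 * σ * α ^ 2 +
      c • (φ * (η₁ * α ^ 2 + 2 * η₂ * σ * α)) - x * w,
    η₂ ^ 3 + b • (η₂ ^ 2 * α) + α ^ 3 + c • (φ * η₂ * α ^ 2))

theorem ev_pullbackCoeffs {p : ℂ × ℂ} (hp : ‖p‖ < 1) (η₁ η₂ η₃ η₄ w : BiSeries) (b c : ℂ) :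
    let t := pullbackCoeffs (η₁, η₂, η₃, η₄, w, b, c)
    let E := BiSeries.evL p
    let X := p.1 * E η₁ + p.2 ^ 3 * E η₂
    let Y := p.2 * E η₃ + p.1 * E η₄
    p.1 ^ 3 * E t.1 + p.1 ^ 2 * p.2 ^ 3 * E t.2.1 + p.1 * p.2 ^ 6 * E t.2.2.1 +
      p.2 ^ 9 * E t.2.2.2 = X ^ 3 + b * X ^ 2 * Y ^ 3 + Y ^ 9 + c * X * Y ^ 7 := by
  simp only [← BiSeries.ev_apply hp, pullbackCoeffs, map_add, map_sub, map_mul, map_pow, map_smul,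
    smul_eq_mul, BiSeries.ev_x, BiSeries.ev_y, map_ofNat]
  ring

theorem contDiff_pullbackCoeffs : ContDiff ℂ 1 pullbackCoeffs := by
  unfold pullbackCoeffs
  fun_prop

theorem pullbackCoeffs_base (b : ℂ) :
    pullbackCoeffs (1, 0, 1, 0, 0, b, 0) = (1, b • 1, 0, 1) := by
  simp [pullbackCoeffs]

theorem hasDerivAt_pullbackCoeffs_line (b : ℂ) (ε₁ ε₂ ε₃ ε₄ w : BiSeries) (β γ : ℂ) :
    HasDerivAt (fun t : ℂ => pullbackCoeffs ((1, 0, 1, 0, 0, b, 0) + t • (ε₁, ε₂, ε₃, ε₄, w, β, γ)))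
      (3 * ε₁ + b • (3 * BiSeries.y ^ 2 * ε₄),
        3 * ε₂ + b • (2 * ε₁ + 3 * ε₃) + β • 1 + BiSeries.y ^ 3 * w,
        b • (2 * ε₂) + 9 * BiSeries.y ^ 2 * ε₄ + γ • BiSeries.y - BiSeries.x * w, 9 * ε₃) 0 := by
  have hlin (u v : BiSeries) : HasDerivAt (fun t : ℂ => u + t • v) v 0 := by
    simpa using ((hasDerivAt_id (0 : ℂ)).smul_const v).const_add u
  have hlin' (u v : ℂ) : HasDerivAt (fun t : ℂ => u + t * v) v 0 := by
    simpa using ((hasDerivAt_id (0 : ℂ)).mul_const v).const_add u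
  have h₁ := hlin 1 ε₁
  have h₂ := hlin 0 ε₂
  have h₃ := hlin 1 ε₃
  have h₄ := hlin 0 ε₄
  have h₅ := hlin 0 w
  have hb := hlin' b β
  have hc := hlin' 0 γ
  have hσ := ((((h₃.pow 2).mul h₄).const_mul (3 * BiSeries.y ^ 2)).add
    ((h₃.mul (h₄.pow 2)).const_mul (3 * BiSeries.y * BiSeries.x))).add
      ((h₄.pow 3).const_mul (BiSeries.x ^ 2))
  have hα := h₃.pow 3
  have hφ := (h₃.const_mul BiSeries.y).add (h₄.const_mul BiSeries.x)
  have c₁ := (((h₁.pow 3).add (hb.smul ((h₁.pow 2).mul hσ))).add (hσ.pow 3)).add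
    (hc.smul ((hφ.mul h₁).mul (hσ.pow 2)))
  have c₂ := ((((((h₁.pow 2).const_mul 3).mul h₂).add
    (hb.smul (((h₁.pow 2).mul hα).add (((h₁.const_mul 2).mul h₂).mul hσ)))).add
    (((hσ.pow 2).const_mul 3).mul hα)).add
    (hc.smul (hφ.mul ((((h₁.const_mul 2).mul hσ).mul hα).add (h₂.mul (hσ.pow 2)))))).add
    (h₅.const_mul (BiSeries.y ^ 3))
  have c₃ := (((((h₁.const_mul 3).mul (h₂.pow 2)).add
    (hb.smul ((((h₁.const_mul 2).mul h₂).mul hα).add ((h₂.pow 2).mul hσ)))).add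
    ((hσ.const_mul 3).mul (hα.pow 2))).add
    (hc.smul (hφ.mul ((h₁.mul (hα.pow 2)).add (((h₂.const_mul 2).mul hσ).mul hα))))).sub
    (h₅.const_mul BiSeries.x)
  have c₄ := (((h₂.pow 3).add (hb.smul ((h₂.pow 2).mul hα))).add (hα.pow 3)).add
    (hc.smul ((hφ.mul h₂).mul (hα.pow 2)))
  refine HasDerivAt.congr_deriv (c₁.prodMk (c₂.prodMk (c₃.prodMk c₄))) ?_
  ext1
  · simp
  ext1
  · simp
    module
  ext1
  · simp
    ring_nf
  · simp
    ring_nf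

theorem range_fderiv_pullbackCoeffs {b : ℂ} (hb : b ≠ 0) (hb' : 4 * b ^ 3 + 27 ≠ 0) :
    (fderiv ℂ pullbackCoeffs (1, 0, 1, 0, 0, b, 0)).range = ⊤ := by
  rw [LinearMap.range_eq_top]
  rintro ⟨t₃, t₂, t₁, t₀⟩
  have hd (ε₁ ε₂ ε₃ ε₄ w : BiSeries) (β γ : ℂ) := HasDerivAt.unique
    ((contDiff_pullbackCoeffs.differentiable (by simp)
      (1, 0, 1, 0, 0, b, 0)).hasFDerivAt.hasLineDerivAt (ε₁, ε₂, ε₃, ε₄, w, β, γ))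
    (hasDerivAt_pullbackCoeffs_line b ε₁ ε₂ ε₃ ε₄ w β γ)
  obtain ⟨r₀, r₁, S, S', hr⟩ := BiSeries.exists_eq_add
    (t₁ - (2 * b / 3) • (t₂ - (2 * b / 3) • t₃ - (b / 3) • t₀))
  have ht₁ : t₁ = (2 * b / 3) • (t₂ - (2 * b / 3) • t₃ - (b / 3) • t₀) +
      (r₀ • 1 + r₁ • BiSeries.y + BiSeries.y ^ 2 * S + BiSeries.x * S') := by
    rw [← hr]; abel
  have hK : 4 * b ^ 3 / 3 + 9 ≠ 0 := by
    intro h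
    apply hb'
    linear_combination 3 * h
  set K := 4 * b ^ 3 / 3 + 9 with hKdef
  set ε₄ := K⁻¹ • (S - (2 * b / 3) • (BiSeries.y * S')) with hε₄
  have hε : K • ε₄ = S - (2 * b / 3) • (BiSeries.y * S') := by
    rw [hε₄, smul_smul, mul_inv_cancel₀ hK, one_smul]
  have hS : S = K • ε₄ + (2 * b / 3) • (BiSeries.y * S') := by rw [hε]; abel
  clear_value ε₄
  set β := -3 * r₀ / (2 * b)
  have hr₀ : r₀ = -(2 * b / 3) * β := by
    simp only [β]
    field_simp
  set ε₁ := (1 / 3 : ℂ) • t₃ - b • (BiSeries.y ^ 2 * ε₄) with hε₁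
  refine ⟨(ε₁, (1 / 3 : ℂ) • (t₂ - β • 1 - (2 * b) • ε₁ - (b / 3) • t₀ + BiSeries.y ^ 3 * S'),
    (1 / 9 : ℂ) • t₀, ε₄, -S', β, r₁), ?_⟩
  refine (hd _ _ _ _ _ _ _).trans ?_
  have n3 : (3 : BiSeries) = (3 : ℂ) • 1 := by
    rw [Algebra.smul_def, mul_one, map_ofNat]
  have n2 : (2 : BiSeries) = (2 : ℂ) • 1 := by
    rw [Algebra.smul_def, mul_one, map_ofNat]
  have n9 : (9 : BiSeries) = (9 : ℂ) • 1 := by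
    rw [Algebra.smul_def, mul_one, map_ofNat]
  rw [n2, n3, n9, ht₁, hS, hr₀, hε₁, hKdef]
  simp only [smul_mul_assoc, mul_smul_comm, one_mul, mul_add, mul_neg, ← mul_assoc,
    ← pow_succ]
  ext1
  · module
  ext1
  · dsimp only
    match_scalars <;> ring
  ext1
  · dsimp only
    match_scalars <;> ring
  · dsimp only
    module

theorem RightEquiv.trans {g₁ g₂ g₃ : ℂ × ℂ → ℂ} (h₁ : RightEquiv g₁ g₂) (h₂ : RightEquiv g₂ g₃) :
    RightEquiv g₁ g₃ := by
  obtain ⟨φ, hφ0, hφ, ⟨L, hL⟩, hφe⟩ := h₁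
  obtain ⟨ψ, hψ0, hψ, ⟨M, hM⟩, hψe⟩ := h₂
  have hψ' : AnalyticAt ℂ ψ (φ 0) := by rwa [hφ0]
  refine ⟨ψ ∘ φ, by simp [hφ0, hψ0], hψ'.comp hφ, ⟨L.trans M, ?_⟩, ?_⟩
  · rw [fderiv_comp 0 hψ'.differentiableAt hφ.differentiableAt, hφ0, hL, hM]
    rfl
  · have hlim : Tendsto φ (nhds 0) (nhds 0) := by simpa [hφ0] using hφ.continuousAt.tendsto
    filter_upwards [hφe, hlim.eventually hψe] with p h₁ h₂
    rw [h₁, h₂, Function.comp_apply]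

/-- Composition with a linear automorphism is a right equivalence. -/
theorem rightEquiv_comp_linear (A : (ℂ × ℂ) ≃L[ℂ] ℂ × ℂ) (g : ℂ × ℂ → ℂ) :
    RightEquiv (fun p => g (A p)) g :=
  ⟨A, map_zero A, A.analyticAt 0, ⟨A, A.fderiv⟩, Eventually.of_forall fun _ => rfl⟩

/-- The lower triangular linear automorphism `(x, y) ↦ (a * x, d * x + c * y)`. -/
noncomputable def lowerTriangularEquiv (a c d : ℂ) (ha : a ≠ 0) (hc : c ≠ 0) :
    (ℂ × ℂ) ≃L[ℂ] ℂ × ℂ :=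
  ContinuousLinearEquiv.equivOfInverse
    ((a • ContinuousLinearMap.fst ℂ ℂ ℂ).prod
      (d • ContinuousLinearMap.fst ℂ ℂ ℂ + c • ContinuousLinearMap.snd ℂ ℂ ℂ))
    ((a⁻¹ • ContinuousLinearMap.fst ℂ ℂ ℂ).prod
      (c⁻¹ • ContinuousLinearMap.snd ℂ ℂ ℂ - (c⁻¹ * d * a⁻¹) • ContinuousLinearMap.fst ℂ ℂ ℂ))
    (fun p => by ext <;> simp <;> field_simp; ring)
    (fun p => by ext <;> simp <;> field_simp; ring)

theorem rightEquiv_of_lowerTriangular {g₁ g₂ : ℂ × ℂ → ℂ} {a b c d : ℂ × ℂ → ℂ}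
    (ha : AnalyticAt ℂ a 0) (hb : AnalyticAt ℂ b 0) (hc : AnalyticAt ℂ c 0)
    (hd : AnalyticAt ℂ d 0) (ha0 : a 0 ≠ 0) (hc0 : c 0 ≠ 0)
    (h : ∀ᶠ p in nhds (0 : ℂ × ℂ), g₁ p = g₂ (p.1 * a p + p.2 ^ 2 * b p, p.2 * c p + p.1 * d p)) :
    RightEquiv g₁ g₂ := by
  have h1 : AnalyticAt ℂ (fun p : ℂ × ℂ => p.1) 0 := analyticAt_fst
  have h2 : AnalyticAt ℂ (fun p : ℂ × ℂ => p.2) 0 := analyticAt_snd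
  refine ⟨fun p => (p.1 * a p + p.2 ^ 2 * b p, p.2 * c p + p.1 * d p), by simp,
    ((h1.mul ha).add ((h2.pow 2).mul hb)).prod ((h2.mul hc).add (h1.mul hd)),
    ⟨lowerTriangularEquiv (a 0) (c 0) (d 0) ha0 hc0, ?_⟩, h⟩
  have d1 : HasFDerivAt (fun p : ℂ × ℂ => p.1) (ContinuousLinearMap.fst ℂ ℂ ℂ) 0 := hasFDerivAt_fst
  have d2 : HasFDerivAt (fun p : ℂ × ℂ => p.2) (ContinuousLinearMap.snd ℂ ℂ ℂ) 0 := hasFDerivAt_snd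
  have hda := ha.differentiableAt.hasFDerivAt
  have hdb := hb.differentiableAt.hasFDerivAt
  have hdc := hc.differentiableAt.hasFDerivAt
  have hdd := hd.differentiableAt.hasFDerivAt
  refine (HasFDerivAt.fderiv (((d1.mul hda).add ((d2.pow 2).mul hdb)).prodMk
    ((d2.mul hdc).add (d1.mul hdd)))).trans ?_
  ext <;> simp [lowerTriangularEquiv]

/-- Near a semi-homogeneous germ `x ^ 3 + b * x ^ 2 * y ^ 3 + y ^ 9` every perturbation of the
coefficients is realised by a change of variables and a change of the parameters. -/
theorem exists_pullbackCoeffs_eq {b : ℂ} (hb : b ≠ 0) (hb' : 4 * b ^ 3 + 27 ≠ 0) :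
    ∀ᶠ t in nhds ((1, b • 1, 0, 1) : BiSeries × BiSeries × BiSeries × BiSeries),
      ∃ (η₁ η₂ η₃ η₄ w : BiSeries) (b' c' : ℂ), BiSeries.evL 0 η₁ ≠ 0 ∧ BiSeries.evL 0 η₃ ≠ 0 ∧
        4 * b' ^ 3 + 27 ≠ 0 ∧ pullbackCoeffs (η₁, η₂, η₃, η₄, w, b', c') = t := by
  have hstrict := (contDiff_pullbackCoeffs.contDiffAt
    (x := (1, 0, 1, 0, 0, b, 0))).hasStrictFDerivAt one_ne_zero
  have hmap := hstrict.map_nhds_eq_of_surj (range_fderiv_pullbackCoeffs hb hb')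
  rw [pullbackCoeffs_base] at hmap
  have hone : BiSeries.evL 0 1 = 1 := by
    rw [← BiSeries.ev_apply (by simp), map_one]
  have h₁ : ∀ᶠ e in nhds ((1, 0, 1, 0, 0, b, 0) :
      BiSeries × BiSeries × BiSeries × BiSeries × BiSeries × ℂ × ℂ), BiSeries.evL 0 e.1 ≠ 0 :=
    ContinuousAt.eventually_ne (by fun_prop) (by simp [hone])
  have h₃ : ∀ᶠ e in nhds ((1, 0, 1, 0, 0, b, 0) :
      BiSeries × BiSeries × BiSeries × BiSeries × BiSeries × ℂ × ℂ),
      BiSeries.evL 0 e.2.2.1 ≠ 0 :=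
    ContinuousAt.eventually_ne (by fun_prop) (by simp [hone])
  have h₆ : ∀ᶠ e in nhds ((1, 0, 1, 0, 0, b, 0) :
      BiSeries × BiSeries × BiSeries × BiSeries × BiSeries × ℂ × ℂ),
      4 * e.2.2.2.2.2.1 ^ 3 + 27 ≠ 0 :=
    ContinuousAt.eventually_ne (by fun_prop) hb'
  rw [← hmap, eventually_map]
  filter_upwards [h₁, h₃, h₆] with e h₁ h₃ h₆
  exact ⟨e.1, e.2.1, e.2.2.1, e.2.2.2.1, e.2.2.2.2.1, e.2.2.2.2.2.1, e.2.2.2.2.2.2, h₁, h₃, h₆, rfl⟩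

/-- A germ with Newton polygon spanned by `x ^ 3` and `y ^ 9`, with nondegenerate principal part
normalised to have no `x * y ^ 6` term, is of type `J_{3,0}`. -/
theorem exists_rightEquiv_J30 {h U V Q S : ℂ × ℂ → ℂ} (hU : AnalyticAt ℂ U 0)
    (hV : AnalyticAt ℂ V 0) (hQ : AnalyticAt ℂ Q 0) (hS : AnalyticAt ℂ S 0)
    (hh : ∀ᶠ p in nhds (0 : ℂ × ℂ), h p = p.1 ^ 3 * U p + p.1 ^ 2 * p.2 ^ 3 * V p +
      p.1 * p.2 ^ 6 * Q p + p.2 ^ 9 * S p)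
    (hU0 : U 0 ≠ 0) (hV0 : V 0 ≠ 0) (hQ0 : Q 0 = 0) (hS0 : S 0 ≠ 0)
    (hdisc : 4 * V 0 ^ 3 + 27 * U 0 ^ 2 * S 0 ≠ 0) :
    ∃ b c : ℂ, 4 * b ^ 3 + 27 ≠ 0 ∧ RightEquiv h (J30 b c) := by
  obtain ⟨μ, hμ⟩ := IsAlgClosed.exists_pow_nat_eq (U 0)⁻¹ (n := 3) (by norm_num)
  obtain ⟨ν, hν⟩ := IsAlgClosed.exists_pow_nat_eq (S 0)⁻¹ (n := 9) (by norm_num)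
  have hμ0 : μ ≠ 0 := by
    rintro rfl
    exact inv_ne_zero hU0 (by rw [← hμ]; simp)
  have hν0 : ν ≠ 0 := by
    rintro rfl
    exact inv_ne_zero hS0 (by rw [← hν]; simp)
  have hμU : μ ^ 3 * U 0 = 1 := by rw [hμ, inv_mul_cancel₀ hU0]
  have hνS : ν ^ 9 * S 0 = 1 := by rw [hν, inv_mul_cancel₀ hS0]
  set b := μ ^ 2 * ν ^ 3 * V 0 with hbdef
  have hb : b ≠ 0 := by positivity
  have hb' : 4 * b ^ 3 + 27 ≠ 0 := by
    have : 4 * b ^ 3 + 27 = μ ^ 6 * ν ^ 9 * (4 * V 0 ^ 3 + 27 * U 0 ^ 2 * S 0) := by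
      linear_combination (-27 * (ν ^ 9 * S 0) * (μ ^ 3 * U 0 + 1)) * hμU - 27 * hνS
    rw [this]
    positivity
  obtain ⟨TU, hTU, hTU'⟩ := hU.exists_scaled_series
  obtain ⟨TV, hTV, hTV'⟩ := hV.exists_scaled_series
  obtain ⟨TQ, hTQ, hTQ'⟩ := hQ.exists_scaled_series
  obtain ⟨TS, hTS, hTS'⟩ := hS.exists_scaled_series
  have hα : Tendsto (fun l : ℂ => ((l ^ 3 * μ, l * ν) : ℂ × ℂ)) (nhdsWithin 0 {0}ᶜ) (nhds 0) := by
    have : Continuous fun l : ℂ => ((l ^ 3 * μ, l * ν) : ℂ × ℂ) := by fun_prop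
    exact (this.tendsto' 0 0 (by simp)).mono_left nhdsWithin_le_nhds
  have hlim := ((hTU.const_smul (μ ^ 3)).prodMk_nhds ((hTV.const_smul (μ ^ 2 * ν ^ 3)).prodMk_nhds
    ((hTQ.const_smul (μ * ν ^ 6)).prodMk_nhds (hTS.const_smul (ν ^ 9))))).comp hα
  simp only [smul_smul, hμU, hνS, ← hbdef, hQ0, smul_zero, zero_smul, one_smul] at hlim
  obtain ⟨l, hl, ⟨η₁, η₂, η₃, η₄, w, b', c', hη₁, hη₃, hb', ht⟩, hlU, hlV, hlQ, hlS⟩ :=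
    ((eventually_mem_nhdsWithin (a := (0 : ℂ)) (s := {0}ᶜ)).and
      ((hlim.eventually (exists_pullbackCoeffs_eq hb hb')).and
      ((hα.eventually hTU').and ((hα.eventually hTV').and
      ((hα.eventually hTQ').and (hα.eventually hTS')))))).exists
  replace hl : l ≠ 0 := hl
  have hscale : RightEquiv h fun p => l ^ 9 * J30 b' c' p := by
    refine RightEquiv.trans (g₂ := fun p => h (l ^ 3 * μ * p.1, l * ν * p.2)) ?_ ?_
    · refine rightEquiv_of_lowerTriangular (a := fun _ => (l ^ 3 * μ)⁻¹) (b := fun _ => 0)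
        (c := fun _ => (l * ν)⁻¹) (d := fun _ => 0) analyticAt_const analyticAt_const
        analyticAt_const analyticAt_const (by positivity) (by positivity)
        (Eventually.of_forall fun p => ?_)
      congr 1
      ext
      · dsimp only
        field_simp
        ring
      · dsimp only
        field_simp
        ring
    · refine rightEquiv_of_lowerTriangular (BiSeries.analyticAt_evL η₁)
        (analyticAt_snd.mul (BiSeries.analyticAt_evL η₂)) (BiSeries.analyticAt_evL η₃)
        (BiSeries.analyticAt_evL η₄) hη₁ hη₃ ?_
      have hD : Tendsto (fun p : ℂ × ℂ => ((l ^ 3 * μ * p.1, l * ν * p.2) : ℂ × ℂ))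
          (nhds 0) (nhds 0) := by
        have : Continuous fun p : ℂ × ℂ => ((l ^ 3 * μ * p.1, l * ν * p.2) : ℂ × ℂ) := by fun_prop
        exact this.tendsto' 0 0 (by simp)
      have hball : ∀ᶠ p in nhds (0 : ℂ × ℂ), ‖p‖ < 1 :=
        continuous_norm.tendsto' (0 : ℂ × ℂ) 0 norm_zero |>.eventually_lt_const one_pos
      filter_upwards [hball, hD.eventually hh] with p hp hhp
      have key := ev_pullbackCoeffs hp η₁ η₂ η₃ η₄ w b' c'
      simp only [ht, Function.comp_apply, map_smul, smul_eq_mul] at key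
      rw [hlU p hp, hlV p hp, hlQ p hp, hlS p hp] at key
      rw [hhp]
      simp only [J30, Pi.mul_apply]
      linear_combination l ^ 9 * key
  refine ⟨b', c' / l, hb', hscale.trans ?_⟩
  refine rightEquiv_of_lowerTriangular (a := fun _ => l ^ 3) (b := fun _ => 0) (c := fun _ => l)
    (d := fun _ => 0) analyticAt_const analyticAt_const analyticAt_const analyticAt_const
    (pow_ne_zero 3 hl) hl (Eventually.of_forall fun p => ?_)
  simp only [J30]
  field_simp
  ring

theorem eval_sum_antidiagonal (n : ℕ) (c : ℕ × ℕ → ℂ) (z : ℂ) :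
    (∑ k ∈ Finset.range (n + 1), Polynomial.C (c (k, n - k)) * Polynomial.X ^ k).eval z =
      ∑ ij ∈ Finset.HasAntidiagonal.antidiagonal n, c ij * (z ^ ij.1 * 1 ^ ij.2) := by
  rw [Finset.Nat.sum_antidiagonal_eq_sum_range_succ_mk]
  simp [Polynomial.eval_finsetSum]

theorem coeff_sum_antidiagonal (n : ℕ) (c : ℕ × ℕ → ℂ) {k : ℕ} (hk : k ≤ n) :
    (∑ k ∈ Finset.range (n + 1), Polynomial.C (c (k, n - k)) * Polynomial.X ^ k).coeff k =
      c (k, n - k) := by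
  simp [Polynomial.finsetSum_coeff, Polynomial.coeff_X_pow, hk]

theorem eq_zero_of_sum_antidiagonal_eq_zero {c : ℕ × ℕ → ℂ} {n : ℕ}
    (h : ∀ x y : ℂ, ∑ ij ∈ Finset.HasAntidiagonal.antidiagonal n, c ij * (x ^ ij.1 * y ^ ij.2) = 0)
    {i j : ℕ} (hij : i + j = n) : c (i, j) = 0 := by
  have hP : (∑ k ∈ Finset.range (n + 1), Polynomial.C (c (k, n - k)) * Polynomial.X ^ k) = 0 :=
    Polynomial.funext fun z => by rw [eval_sum_antidiagonal, h, Polynomial.eval_zero]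
  obtain rfl : j = n - i := by omega
  rw [← coeff_sum_antidiagonal n c (by omega : i ≤ n), hP, Polynomial.coeff_zero]

theorem exists_ne_zero_sum_antidiagonal_eq_zero (c : ℕ × ℕ → ℂ) {n : ℕ} (hn : n ≠ 0) :
    ∃ v : ℂ × ℂ, v ≠ 0 ∧
      ∑ ij ∈ Finset.HasAntidiagonal.antidiagonal n, c ij * (v.1 ^ ij.1 * v.2 ^ ij.2) = 0 := by
  by_cases h : c (n, 0) = 0
  · refine ⟨(1, 0), by simp, Finset.sum_eq_zero fun ij hij => ?_⟩
    obtain ⟨i, j⟩ := ij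
    rw [Finset.HasAntidiagonal.mem_antidiagonal] at hij
    rcases eq_or_ne j 0 with rfl | hj
    · obtain rfl : i = n := by simpa using hij
      simp [h]
    · simp [hj]
  · set P := ∑ k ∈ Finset.range (n + 1), Polynomial.C (c (k, n - k)) * Polynomial.X ^ k with hP
    have hcoeff : P.coeff n ≠ 0 := by
      rw [hP, coeff_sum_antidiagonal n c le_rfl]
      simpa using h
    have hdeg : P.degree ≠ 0 := by
      have := Polynomial.le_degree_of_ne_zero hcoeff
      intro h0
      rw [h0] at this
      exact hn (by simpa using this)
    obtain ⟨z, hz⟩ := IsAlgClosed.exists_root P hdeg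
    exact ⟨(z, 1), by simp, by rw [← eval_sum_antidiagonal]; exact hz⟩

theorem BiSeries.exists_decomposition {T : BiSeries}
    (hT : ∀ i j, i + j ≤ 6 → coeffₗ j (coeffₗ i T) = 0) (hT' : coeffₗ 7 (coeffₗ 0 T) = 0) :
    ∃ (A₅ A₄ A₃ A₂ A₁ A₀ : BiSeries) (a₁ a₀ : ℂ),
      T = x ^ 5 * A₅ + x ^ 4 * y * A₄ + x ^ 3 * y ^ 3 * A₃ + x ^ 2 * y ^ 5 * A₂ +
        x * y ^ 6 * (a₁ • 1 + y * A₁) + y ^ 8 * (a₀ • 1 + y * A₀) := by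
  have hsplit (p : SummableSeries ℂ) : ∃ (a : ℂ) (q : SummableSeries ℂ), p = a • 1 + X * q := by
    obtain ⟨q, hq, -⟩ := p.exists_eq_C_add_X_mul
    refine ⟨coeffₗ 0 p, q, ?_⟩
    rwa [← C_one, ← C_smul, smul_eq_mul, mul_one]
  obtain ⟨T₁, h₀, c₁⟩ := T.exists_eq_C_add_X_mul
  obtain ⟨T₂, h₁, c₂⟩ := T₁.exists_eq_C_add_X_mul
  obtain ⟨T₃, h₂, c₃⟩ := T₂.exists_eq_C_add_X_mul
  obtain ⟨T₄, h₃, c₄⟩ := T₃.exists_eq_C_add_X_mul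
  obtain ⟨T₅, h₄, -⟩ := T₄.exists_eq_C_add_X_mul
  simp only [c₁, c₂, c₃, c₄, zero_add] at h₁ h₂ h₃ h₄
  obtain ⟨q₄, e₄, -⟩ := exists_eq_X_pow_mul 1 (coeffₗ 4 T) fun i hi => hT 4 i (by omega)
  obtain ⟨q₃, e₃, -⟩ := exists_eq_X_pow_mul 3 (coeffₗ 3 T) fun i hi => hT 3 i (by omega)
  obtain ⟨q₂, e₂, -⟩ := exists_eq_X_pow_mul 5 (coeffₗ 2 T) fun i hi => hT 2 i (by omega)
  obtain ⟨q₁, e₁, -⟩ := exists_eq_X_pow_mul 6 (coeffₗ 1 T) fun i hi => hT 1 i (by omega)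
  obtain ⟨q₀, e₀, -⟩ := exists_eq_X_pow_mul 8 (coeffₗ 0 T) fun i hi => by
    rcases eq_or_ne i 7 with rfl | h
    · exact hT'
    · exact hT 0 i (by omega)
  obtain ⟨a₁, r₁, f₁⟩ := hsplit q₁
  obtain ⟨a₀, r₀, f₀⟩ := hsplit q₀
  refine ⟨T₅, C q₄, C q₃, C q₂, C r₁, C r₀, a₁, a₀, ?_⟩
  rw [h₀, h₁, h₂, h₃, h₄]
  simp only [e₄, e₃, e₂, e₁, e₀, C_pow_mul]
  simp only [f₁, f₀, C_add, C_mul, C_smul, C_one, x, y]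
  ring

theorem AnalyticAt.exists_decomposition {f : ℂ × ℂ → ℂ} (hf : AnalyticAt ℂ f 0)
    (hjet : ∀ k ≤ 6, iteratedFDeriv ℂ k f 0 = 0)
    (hjet' : iteratedFDeriv ℂ 7 f 0 (fun _ => (0, 1)) = 0) :
    ∃ (A₅ A₄ A₃ A₂ A₁ A₀ : ℂ × ℂ → ℂ) (a₁ a₀ : ℂ), AnalyticAt ℂ A₅ 0 ∧ AnalyticAt ℂ A₄ 0 ∧
      AnalyticAt ℂ A₃ 0 ∧ AnalyticAt ℂ A₂ 0 ∧ AnalyticAt ℂ A₁ 0 ∧ AnalyticAt ℂ A₀ 0 ∧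
      ∀ᶠ p in nhds (0 : ℂ × ℂ), f p = p.1 ^ 5 * A₅ p + p.1 ^ 4 * p.2 * A₄ p +
        p.1 ^ 3 * p.2 ^ 3 * A₃ p + p.1 ^ 2 * p.2 ^ 5 * A₂ p + p.1 * p.2 ^ 6 * (a₁ + p.2 * A₁ p) +
        p.2 ^ 8 * (a₀ + p.2 * A₀ p) := by
  obtain ⟨ρ, hρ, c, hc, hsum, hc'⟩ := hf.exists_hasSum_double
  have hρ' : (ρ : ℂ) ≠ 0 := by exact_mod_cast hρ.ne'
  set r := (ρ : ℂ)⁻¹ with hr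
  have hlow (i j : ℕ) (hij : i + j ≤ 6) : c (i, j) = 0 :=
    eq_zero_of_sum_antidiagonal_eq_zero (fun x y => by rw [hc', hjet _ hij]; simp) rfl
  have hseven : c (0, 7) = 0 := by
    have h := hc' 7 0 1
    rw [hjet', mul_zero, Finset.sum_eq_single (0, 7)] at h
    · simpa using h
    · rintro ⟨i, j⟩ hij hne
      rw [Finset.HasAntidiagonal.mem_antidiagonal] at hij
      have : i ≠ 0 := by
        rintro rfl
        exact hne (by simpa using hij)
      simp [this]
    · simp
  have hs : Summable fun ij : ℕ × ℕ => ‖c ij * (ρ : ℂ) ^ (ij.1 + ij.2)‖ := by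
    refine hc.congr fun ij => ?_
    rw [norm_mul, norm_pow, Complex.norm_real, Real.norm_of_nonneg hρ.le]
  set T := BiSeries.ofCoeffs _ hs with hTdef
  obtain ⟨B₅, B₄, B₃, B₂, B₁, B₀, b₁, b₀, hT⟩ := BiSeries.exists_decomposition (T := T)
    (fun i j hij => by simp [hTdef, hlow i j hij]) (by simp [hTdef, hseven])
  have hana (n : ℕ) (B : BiSeries) :
      AnalyticAt ℂ (fun p : ℂ × ℂ => r ^ n * BiSeries.evL (r • p) B) 0 := by
    refine analyticAt_const.mul ?_
    have h : AnalyticAt ℂ (fun p => BiSeries.evL p B) (r • (0 : ℂ × ℂ)) := by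
      rw [smul_zero]
      exact BiSeries.analyticAt_evL B
    exact h.fun_comp (f := fun p : ℂ × ℂ => r • p) (by fun_prop)
  refine ⟨_, _, _, _, _, _, r ^ 7 * b₁, r ^ 8 * b₀, hana 5 B₅, hana 5 B₄, hana 6 B₃, hana 7 B₂,
    hana 8 B₁, hana 9 B₀, ?_⟩
  have hball : ∀ᶠ p in nhds (0 : ℂ × ℂ), ‖p‖ < ρ :=
    continuous_norm.tendsto' (0 : ℂ × ℂ) 0 norm_zero |>.eventually_lt_const hρ
  filter_upwards [hball] with p hp
  have hrp : ‖r • p‖ < 1 := by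
    rw [norm_smul, hr, norm_inv, Complex.norm_real, Real.norm_of_nonneg hρ.le,
      inv_mul_lt_iff₀ hρ, mul_one]
    exact hp
  have hfp : f p = BiSeries.evL (r • p) T := by
    refine (hsum p hp).unique ((BiSeries.hasSum_evL_ofCoeffs _ hs hrp).congr_fun fun ij => ?_)
    simp only [Prod.smul_fst, Prod.smul_snd, smul_eq_mul, mul_pow, hr, pow_add, inv_pow]
    field_simp
  rw [hfp, hT]
  simp only [← BiSeries.ev_apply hrp, map_add, map_mul, map_pow, map_smul, map_one, smul_eq_mul,
    BiSeries.ev_x, BiSeries.ev_y, Prod.smul_fst, Prod.smul_snd]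
  ring

/-- If the cubic `v * (x - s * y ^ 2) ^ 3` is added to a suitable germ of order `7`, a shift of `x`
by `s * y ^ 2 + κ * y ^ 3` brings the sum into a form to which `exists_rightEquiv_J30` applies. -/
theorem exists_rightEquiv_J30_of_add_cube {G A₅ A₄ A₃ A₂ A₁ A₀ : ℂ × ℂ → ℂ} {a a₀ s κ v : ℂ}
    (h₅ : AnalyticAt ℂ A₅ 0) (h₄ : AnalyticAt ℂ A₄ 0) (h₃ : AnalyticAt ℂ A₃ 0)
    (h₂ : AnalyticAt ℂ A₂ 0) (h₁ : AnalyticAt ℂ A₁ 0) (h₀ : AnalyticAt ℂ A₀ 0)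
    (hG : ∀ᶠ p in nhds (0 : ℂ × ℂ), G p = p.1 ^ 5 * A₅ p + p.1 ^ 4 * p.2 * A₄ p +
      p.1 ^ 3 * p.2 ^ 3 * A₃ p + p.1 ^ 2 * p.2 ^ 5 * A₂ p + p.1 * p.2 ^ 6 * (a + p.2 * A₁ p) +
      p.2 ^ 8 * (a₀ + p.2 * A₀ p) + v * (p.1 - s * p.2 ^ 2) ^ 3)
    (hs : s * a + a₀ = 0) (hκ : a + 3 * v * κ ^ 2 = 0) (hv : v ≠ 0) (hκ0 : κ ≠ 0)
    (hS : s ^ 4 * A₄ 0 + s ^ 3 * A₃ 0 + s ^ 2 * A₂ 0 + s * A₁ 0 + A₀ 0 - 2 * v * κ ^ 3 ≠ 0)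
    (hdisc : s ^ 4 * A₄ 0 + s ^ 3 * A₃ 0 + s ^ 2 * A₂ 0 + s * A₁ 0 + A₀ 0 + 2 * v * κ ^ 3 ≠ 0) :
    ∃ b c : ℂ, 4 * b ^ 3 + 27 ≠ 0 ∧ RightEquiv G (J30 b c) := by
  set ψ : ℂ × ℂ → ℂ × ℂ := fun p => (p.1 + p.2 ^ 2 * (s + κ * p.2), p.2) with hψ
  have hψ0 : ψ 0 = 0 := by simp [hψ]
  have p₁ : AnalyticAt ℂ (fun p : ℂ × ℂ => p.1) 0 := analyticAt_fst
  have p₂ : AnalyticAt ℂ (fun p : ℂ × ℂ => p.2) 0 := analyticAt_snd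
  have hψa : AnalyticAt ℂ ψ 0 :=
    (p₁.fun_add ((p₂.fun_pow 2).fun_mul
      (analyticAt_const.fun_add (analyticAt_const.fun_mul p₂)))).prod p₂
  have hcomp {A : ℂ × ℂ → ℂ} (hA : AnalyticAt ℂ A 0) :
      ∃ B, AnalyticAt ℂ B 0 ∧ B 0 = A 0 ∧ ∀ p, A (ψ p) = B p := by
    refine ⟨fun p => A (ψ p), ?_, congrArg A hψ0, fun _ => rfl⟩
    rw [← hψ0] at hA
    exact hA.fun_comp hψa
  obtain ⟨B₅, k₅, z₅, e₅⟩ := hcomp h₅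
  obtain ⟨B₄, k₄, z₄, e₄⟩ := hcomp h₄
  obtain ⟨B₃, k₃, z₃, e₃⟩ := hcomp h₃
  obtain ⟨B₂, k₂, z₂, e₂⟩ := hcomp h₂
  obtain ⟨B₁, k₁, z₁, e₁⟩ := hcomp h₁
  obtain ⟨B₀, k₀, z₀, e₀⟩ := hcomp h₀
  have hlim : Tendsto ψ (nhds 0) (nhds 0) := by simpa [hψ0] using hψa.continuousAt.tendsto
  have hshift : RightEquiv G fun p => G (ψ p) := by
    refine rightEquiv_of_lowerTriangular (a := fun _ => 1) (b := fun p => -(s + κ * p.2))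
      (c := fun _ => 1) (d := fun _ => 0) analyticAt_const (by fun_prop) analyticAt_const
      analyticAt_const one_ne_zero one_ne_zero (Eventually.of_forall fun p => ?_)
    simp only [hψ]
    congr 1
    ext <;> simp; ring
  obtain ⟨b, c, hbc, h⟩ := exists_rightEquiv_J30 (h := fun p => G (ψ p))
    (U := fun p => v + B₅ p * (p.1 ^ 2 + 5 * p.1 * p.2 ^ 2 * (s + κ * p.2) +
      10 * p.2 ^ 4 * (s + κ * p.2) ^ 2) +
      B₄ p * p.2 * (p.1 + 4 * p.2 ^ 2 * (s + κ * p.2)) + B₃ p * p.2 ^ 3)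
    (V := fun p => 3 * v * κ + B₅ p * (10 * p.2 ^ 3 * (s + κ * p.2) ^ 3) +
      B₄ p * (6 * p.2 ^ 2 * (s + κ * p.2) ^ 2) + B₃ p * (3 * p.2 ^ 2 * (s + κ * p.2)) +
      B₂ p * p.2 ^ 2)
    (Q := fun p => a + 3 * v * κ ^ 2 + B₅ p * (5 * p.2 ^ 2 * (s + κ * p.2) ^ 4) +
      B₄ p * (4 * p.2 * (s + κ * p.2) ^ 3) + B₃ p * (3 * p.2 * (s + κ * p.2) ^ 2) +
      B₂ p * (2 * p.2 * (s + κ * p.2)) + B₁ p * p.2)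
    (S := fun p => v * κ ^ 3 + κ * a + B₅ p * (p.2 * (s + κ * p.2) ^ 5) +
      B₄ p * (s + κ * p.2) ^ 4 + B₃ p * (s + κ * p.2) ^ 3 +
      B₂ p * (s + κ * p.2) ^ 2 + B₁ p * (s + κ * p.2) + B₀ p)
    (by fun_prop) (by fun_prop) (by fun_prop) (by fun_prop)
    (by
      filter_upwards [hlim.eventually hG] with p hp
      rw [hp, e₅, e₄, e₃, e₂, e₁, e₀]
      simp only [hψ]
      linear_combination p.2 ^ 8 * hs)
    (by simpa using hv) (by simp [hv, hκ0]) (by simp [hκ])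
    (by
      convert hS using 1
      simp only [Prod.snd_zero, z₄, z₃, z₂, z₁, z₀]
      linear_combination κ * hκ)
    (by
      have := mul_ne_zero (mul_ne_zero (by norm_num : (27 : ℂ) ≠ 0) (pow_ne_zero 2 hv)) hdisc
      convert this using 1
      simp only [Prod.fst_zero, Prod.snd_zero, z₄, z₃, z₂, z₁, z₀]
      linear_combination 27 * v ^ 2 * κ * hκ)
  exact ⟨b, c, hbc, hshift.trans h⟩

theorem exists_deformation_of_iteratedFDeriv_seven {f : ℂ × ℂ → ℂ} (hf : AnalyticAt ℂ f 0)
    (hjet : ∀ k ≤ 6, iteratedFDeriv ℂ k f 0 = 0)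
    (hjet' : iteratedFDeriv ℂ 7 f 0 (fun _ => (0, 1)) = 0) :
    ∃ F : (ℂ × ℂ) × EuclideanSpace ℂ (Fin 3) → ℂ, AnalyticAt ℂ F 0 ∧ (∀ p, F (p, 0) = f p) ∧
      ∀ ε > (0 : ℝ), ∃ u : EuclideanSpace ℂ (Fin 3), 0 < ‖u‖ ∧ ‖u‖ < ε ∧
        ∃ b c : ℂ, 4 * b ^ 3 + 27 ≠ 0 ∧ RightEquiv (fun p => F (p, u)) (J30 b c) := by
  obtain ⟨A₅, A₄, A₃, A₂, A₁, A₀, a₁, a₀, h₅, h₄, h₃, h₂, h₁, h₀, hfe⟩ :=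
    hf.exists_decomposition hjet hjet'
  refine ⟨fun q => f q.1 + q.2 0 * (q.1.1 * q.1.2 ^ 6) + (q.2 1 * q.1.1 - q.2 2 * q.1.2 ^ 2) ^ 3,
    ?_, fun p => by simp, fun ε hε => ?_⟩
  · have hcoord (i : Fin 3) :
        AnalyticAt ℂ (fun q : (ℂ × ℂ) × EuclideanSpace ℂ (Fin 3) => q.2 i) 0 :=
      ((EuclideanSpace.proj (𝕜 := ℂ) i).comp
        (ContinuousLinearMap.snd ℂ (ℂ × ℂ) (EuclideanSpace ℂ (Fin 3)))).analyticAt 0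
    have hf' : AnalyticAt ℂ (fun q : (ℂ × ℂ) × EuclideanSpace ℂ (Fin 3) => f q.1) 0 :=
      AnalyticAt.fun_comp (g := f) hf analyticAt_fst
    have hx : AnalyticAt ℂ (fun q : (ℂ × ℂ) × EuclideanSpace ℂ (Fin 3) => q.1.1) 0 :=
      AnalyticAt.fun_comp (g := Prod.fst) analyticAt_fst analyticAt_fst
    have hy : AnalyticAt ℂ (fun q : (ℂ × ℂ) × EuclideanSpace ℂ (Fin 3) => q.1.2) 0 :=
      AnalyticAt.fun_comp (g := Prod.snd) analyticAt_snd analyticAt_fst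
    have c₀ := hcoord 0
    have c₁ := hcoord 1
    have c₂ := hcoord 2
    exact (hf'.fun_add (c₀.fun_mul (hx.fun_mul (hy.fun_pow 6)))).fun_add
      (((c₁.fun_mul hx).fun_sub (c₂.fun_mul (hy.fun_pow 2))).fun_pow 3)
  obtain ⟨δ, hδ, hδ0⟩ : ∃ δ : ℂ, ‖δ‖ < ε ∧ a₁ + δ ≠ 0 := by
    by_cases h : a₁ = 0
    · refine ⟨(ε / 2 : ℝ), ?_, ?_⟩
      · rw [Complex.norm_real, Real.norm_of_nonneg (by positivity)]
        exact half_lt_self hε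
      · rw [h, zero_add]
        exact_mod_cast (half_pos hε).ne'
    · exact ⟨0, by simpa using hε, by simpa using h⟩
  set s := -a₀ / (a₁ + δ) with hs
  obtain ⟨ζ, hζ⟩ := IsAlgClosed.exists_pow_nat_eq (-(a₁ + δ) / 3) (n := 2) two_pos
  have hζ0 : ζ ≠ 0 := by
    rintro rfl
    apply hδ0
    linear_combination 3 * hζ
  set N := s ^ 4 * A₄ 0 + s ^ 3 * A₃ 0 + s ^ 2 * A₂ 0 + s * A₁ 0 + A₀ 0
  set u : ℂ → EuclideanSpace ℂ (Fin 3) := fun t => !₂[δ, t ^ 2, t ^ 2 * s] with hu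
  have hucont : Continuous u := by
    refine (PiLp.continuous_toLp 2 _).comp (continuous_pi fun i => ?_)
    fin_cases i <;> simp <;> fun_prop
  have hu0 : ‖u 0‖ = ‖δ‖ := by
    rw [EuclideanSpace.norm_eq]
    simp [hu, Fin.sum_univ_three]
  have hnorm : ∀ᶠ t in nhds (0 : ℂ), ‖u t‖ < ε :=
    (hucont.norm.tendsto 0).eventually_lt_const (by rwa [hu0])
  have hsub : ∀ᶠ t in nhds (0 : ℂ), N * t ^ 3 - 2 * ζ ^ 3 ≠ 0 :=
    ContinuousAt.eventually_ne (by fun_prop) (by simp [hζ0])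
  have hadd : ∀ᶠ t in nhds (0 : ℂ), N * t ^ 3 + 2 * ζ ^ 3 ≠ 0 :=
    ContinuousAt.eventually_ne (by fun_prop) (by simp [hζ0])
  obtain ⟨t, ht, htn, htsub, htadd⟩ :=
    ((eventually_mem_nhdsWithin (a := (0 : ℂ)) (s := {0}ᶜ)).and
      ((hnorm.and (hsub.and hadd)).filter_mono nhdsWithin_le_nhds)).exists
  replace ht : t ≠ 0 := ht
  refine ⟨u t, ?_, htn, ?_⟩
  · rw [norm_pos_iff]
    intro h
    have : u t 1 = 0 := by rw [h]; rfl
    exact pow_ne_zero 2 ht this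
  · refine exists_rightEquiv_J30_of_add_cube (a := a₁ + δ) (a₀ := a₀) (s := s) (κ := ζ / t ^ 3)
      (v := t ^ 6) h₅ h₄ h₃ h₂ h₁ h₀ ?_ ?_ ?_ (by positivity) (by positivity) ?_ ?_
    · filter_upwards [hfe] with p hp
      rw [hp]
      simp [hu]
      ring
    · rw [hs]
      field_simp
      ring
    · field_simp
      linear_combination 3 * hζ
    · intro h
      apply htsub
      field_simp at h
      linear_combination h
    · intro h
      apply htadd
      field_simp at h
      linear_combination h

/-- Every analytic germ `f : (ℂ², 0) → (ℂ, 0)` with an isolated singularity at `0` and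
vanishing `6`-jet at `0` deforms to `J_{3,0}`. -/
theorem zero_six_jet_deforms_to_J30 (f : ℂ × ℂ → ℂ)
    (hf : AnalyticAt ℂ f 0) (hf0 : f 0 = 0)
    (hjet : ∀ k : ℕ, k ≤ 6 → iteratedFDeriv ℂ k f 0 = 0)
    (hiso : ∃ ε > (0 : ℝ), ∀ p : ℂ × ℂ, ‖p‖ < ε → p ≠ 0 → fderiv ℂ f p ≠ 0) :
    ∃ m : ℕ, 1 ≤ m ∧ ∃ F : (ℂ × ℂ) × EuclideanSpace ℂ (Fin m) → ℂ,
      AnalyticAt ℂ F 0 ∧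
      (∀ᶠ p in nhds (0 : ℂ × ℂ), F (p, 0) = f p) ∧
      ∀ ε > (0 : ℝ), ∃ u : EuclideanSpace ℂ (Fin m), 0 < ‖u‖ ∧ ‖u‖ < ε ∧
        ∃ b c : ℂ, 4 * b ^ 3 + 27 ≠ 0 ∧
          RightEquiv (fun p => F (p, u)) (J30 b c) := by
  obtain ⟨-, -, c, -, -, hc⟩ := hf.exists_hasSum_double
  obtain ⟨v, hv, hcv⟩ := exists_ne_zero_sum_antidiagonal_eq_zero c (n := 7) (by norm_num)
  rw [hc, mul_eq_zero, or_iff_right (inv_ne_zero (Nat.cast_ne_zero.2 (Nat.factorial_ne_zero 7)))]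
    at hcv
  obtain ⟨A, hA⟩ := SeparatingDual.exists_continuousLinearEquiv_apply_eq (R := ℂ)
    (x := ((0, 1) : ℂ × ℂ)) (y := v) (by simp) hv
  have hfA : AnalyticAt ℂ (f ∘ A) 0 :=
    AnalyticAt.comp (by rwa [map_zero]) (A.analyticAt 0)
  have hiter (k : ℕ) : iteratedFDeriv ℂ k (f ∘ A) 0 =
      (iteratedFDeriv ℂ k f 0).compContinuousLinearMap fun _ => (A : ℂ × ℂ →L[ℂ] ℂ × ℂ) := by
    simpa [iteratedFDerivWithin_univ] using
      A.iteratedFDerivWithin_comp_right f uniqueDiffOn_univ (Set.mem_univ (A 0)) k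
  obtain ⟨F, hF, hF0, hFu⟩ := exists_deformation_of_iteratedFDeriv_seven hfA
    (fun k hk => by rw [hiter, hjet k hk]; rfl)
    (by
      rw [hiter, ContinuousMultilinearMap.compContinuousLinearMap_apply]
      simpa [hA] using hcv)
  refine ⟨3, by norm_num, fun q => F (A.symm q.1, q.2), ?_, ?_, fun ε hε => ?_⟩
  · have hA' : AnalyticAt ℂ
        (fun q : (ℂ × ℂ) × EuclideanSpace ℂ (Fin 3) => (A.symm q.1, q.2)) 0 :=
      (AnalyticAt.fun_comp (g := A.symm) (A.symm.analyticAt _) analyticAt_fst).prod analyticAt_snd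
    exact AnalyticAt.fun_comp (by rwa [Prod.fst_zero, map_zero, Prod.snd_zero]) hA'
  · exact Eventually.of_forall fun p => by simp [hF0]
  · obtain ⟨u, hu, huε, b, c, hbc, h⟩ := hFu ε hε
    exact ⟨u, hu, huε, b, c, hbc, (rightEquiv_comp_linear A.symm _).trans h⟩
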